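/- Let X and Y be finite simple graphs, each with n vertices, and let A be a unital *-ring containing an Iso(X,Y)-family (e_{x,y}). Let U be the n × n matrix over A with entries U_{g,h} = e_{g,h} for g ∈ V(X), h ∈ V(Y). Then U is a unitary over A, i.e. U·Uᴴ = Uᴴ·U = 1 where Uᴴ denotes the star-conjugate transpose, and moreover A_X·U = U·A_Y, where A_X and A_Y are the 0-1 adjacency matrices of X and Y regarded as matrices with entries in A. -/

import Mathlib

open Finset Matrix

/-- The `rel` function of a pair of graphs, defined on the disjoint union of the vertex
sets: `0` if the vertices are equal, `-1` if adjacent, `+1` if distinct and non-adjacent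
(within one graph); the junk value `2` for mixed pairs. -/
def relS {VX VY : Type*} [DecidableEq VX] [DecidableEq VY]
    (X : SimpleGraph VX) (Y : SimpleGraph VY)
    [DecidableRel X.Adj] [DecidableRel Y.Adj] :
    VX ⊕ VY → VX ⊕ VY → ℤ
  | Sum.inl v, Sum.inl w => if v = w then 0 else if X.Adj v w then -1 else 1
  | Sum.inr v, Sum.inr w => if v = w then 0 else if Y.Adj v w then -1 else 1
  | _, _ => 2

/-- The rules of the graph isomorphism game `Iso(X,Y)`: on inputs `v, w` and outputs
`x, y`, the players win iff all the listed conditions hold. -/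
def isoRule {VX VY : Type*} [DecidableEq VX] [DecidableEq VY]
    (X : SimpleGraph VX) (Y : SimpleGraph VY)
    [DecidableRel X.Adj] [DecidableRel Y.Adj]
    (v w x y : VX ⊕ VY) : Prop :=
  x.isLeft ≠ v.isLeft ∧ y.isLeft ≠ w.isLeft ∧
  (v.isLeft = w.isLeft → relS X Y v w = relS X Y x y) ∧
  (v.isLeft ≠ w.isLeft → x = w → y = v) ∧
  (v.isLeft ≠ w.isLeft → y = v → x = w)

/-- An `Iso(X,Y)`-family in a unital `*`-ring `A`: self-adjoint idempotents `e x y`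
indexed by the disjoint union of the vertex sets, with each row summing to `1`,
orthogonality along rows, and the products prescribed to vanish whenever the
corresponding input-output quadruple violates the rules of the isomorphism game. -/
structure IsoFamily {VX VY : Type*} [Fintype VX] [Fintype VY]
    [DecidableEq VX] [DecidableEq VY]
    (X : SimpleGraph VX) (Y : SimpleGraph VY)
    [DecidableRel X.Adj] [DecidableRel Y.Adj]
    (A : Type*) [Ring A] [StarRing A] where
  e : (VX ⊕ VY) → (VX ⊕ VY) → A
  selfadj : ∀ x y, star (e x y) = e x y
  idem : ∀ x y, e x y * e x y = e x y
  rowsum : ∀ x, ∑ y, e x y = 1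
  row_orth : ∀ x y y', y ≠ y' → e x y * e x y' = 0
  rule : ∀ v w x y, ¬ isoRule X Y v w x y → e v x * e w y = 0

namespace IsoFamily

variable {VX VY : Type*} [Fintype VX] [Fintype VY] [DecidableEq VX] [DecidableEq VY]
  {X : SimpleGraph VX} {Y : SimpleGraph VY} [DecidableRel X.Adj] [DecidableRel Y.Adj]
  {A : Type*} [Ring A] [StarRing A]

theorem e_inl_inl (E : IsoFamily X Y A) (g g' : VX) : E.e (Sum.inl g) (Sum.inl g') = 0 := by
  rw [← E.idem]
  exact E.rule _ _ _ _ fun h => h.1 rfl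

theorem e_inr_inr (E : IsoFamily X Y A) (h h' : VY) : E.e (Sum.inr h) (Sum.inr h') = 0 := by
  rw [← E.idem]
  exact E.rule _ _ _ _ fun h => h.1 rfl

theorem sum_e_inl_inr (E : IsoFamily X Y A) (g : VX) :
    ∑ h, E.e (Sum.inl g) (Sum.inr h) = 1 := by
  simpa [e_inl_inl] using E.rowsum (Sum.inl g)

theorem sum_e_inr_inl (E : IsoFamily X Y A) (h : VY) :
    ∑ g, E.e (Sum.inr h) (Sum.inl g) = 1 := by
  simpa [e_inr_inr] using E.rowsum (Sum.inr h)

theorem e_inl_inr_eq_e_inr_inl (E : IsoFamily X Y A) (g : VX) (h : VY) :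
    E.e (Sum.inl g) (Sum.inr h) = E.e (Sum.inr h) (Sum.inl g) := by
  trans E.e (Sum.inl g) (Sum.inr h) * E.e (Sum.inr h) (Sum.inl g)
  · conv_lhs => rw [← mul_one (E.e (Sum.inl g) (Sum.inr h)), ← E.sum_e_inr_inl h, Finset.mul_sum]
    refine Finset.sum_eq_single_of_mem g (Finset.mem_univ g) fun g' _ hg => ?_
    refine E.rule _ _ _ _ fun hr => hg (Sum.inl_injective (hr.2.2.2.1 (by simp) rfl))
  · conv_rhs => rw [← one_mul (E.e (Sum.inr h) (Sum.inl g)), ← E.sum_e_inl_inr g, Finset.sum_mul]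
    symm
    refine Finset.sum_eq_single_of_mem h (Finset.mem_univ h) fun h' _ hh => ?_
    refine E.rule _ _ _ _ fun hr => hh (Sum.inr_injective (hr.2.2.2.2 (by simp) rfl))

theorem sum_e_inl_inr_left (E : IsoFamily X Y A) (h : VY) :
    ∑ g, E.e (Sum.inl g) (Sum.inr h) = 1 := by
  simp_rw [e_inl_inr_eq_e_inr_inl, sum_e_inr_inl]

theorem e_mul_e_eq_zero_of_rel_ne (E : IsoFamily X Y A) {g g' : VX} {h h' : VY}
    (hne : relS X Y (Sum.inl g) (Sum.inl g') ≠ relS X Y (Sum.inr h) (Sum.inr h')) :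
    E.e (Sum.inl g) (Sum.inr h) * E.e (Sum.inl g') (Sum.inr h') = 0 :=
  E.rule _ _ _ _ fun hr => hne (hr.2.2.1 rfl)

theorem e_mul_e_eq_zero_of_ne_left (E : IsoFamily X Y A) {g g' : VX} (hg : g ≠ g') (h : VY) :
    E.e (Sum.inl g) (Sum.inr h) * E.e (Sum.inl g') (Sum.inr h) = 0 :=
  E.e_mul_e_eq_zero_of_rel_ne <| by
    simp only [relS, hg, if_false, if_true]
    split_ifs <;> decide

theorem e_mul_e_eq_zero_of_ne_right (E : IsoFamily X Y A) (g : VX) {h h' : VY} (hh : h ≠ h') :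
    E.e (Sum.inl g) (Sum.inr h) * E.e (Sum.inl g) (Sum.inr h') = 0 :=
  E.row_orth _ _ _ fun he => hh (Sum.inr_injective he)

theorem e_mul_e_eq_zero_of_not_adj_iff (E : IsoFamily X Y A) {g g' : VX} {h h' : VY}
    (hadj : ¬ (X.Adj g g' ↔ Y.Adj h h')) :
    E.e (Sum.inl g) (Sum.inr h) * E.e (Sum.inl g') (Sum.inr h') = 0 :=
  E.e_mul_e_eq_zero_of_rel_ne fun hrel => hadj <| by
    have hX : X.Adj g g' ↔ relS X Y (Sum.inl g) (Sum.inl g') = -1 := by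
      rcases eq_or_ne g g' with rfl | hg
      · simp [relS]
      · by_cases ha : X.Adj g g' <;> simp [relS, hg, ha]
    have hY : Y.Adj h h' ↔ relS X Y (Sum.inr h) (Sum.inr h') = -1 := by
      rcases eq_or_ne h h' with rfl | hh
      · simp [relS]
      · by_cases ha : Y.Adj h h' <;> simp [relS, hh, ha]
    rw [hX, hY, hrel]

end IsoFamily

/-- the matrix `U = (e (g,h))_{g ∈ V(X), h ∈ V(Y)}` of an `Iso(X,Y)`-family
is a unitary over `A` and intertwines the adjacency matrices: `A_X U = U A_Y`. -/
theorem stmt4 {VX VY : Type*} [Fintype VX] [Fintype VY]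
    [DecidableEq VX] [DecidableEq VY]
    (X : SimpleGraph VX) (Y : SimpleGraph VY)
    [DecidableRel X.Adj] [DecidableRel Y.Adj]
    (n : ℕ) (hX : Fintype.card VX = n) (hY : Fintype.card VY = n)
    (A : Type*) [Ring A] [StarRing A]
    (E : IsoFamily X Y A) :
    let U : Matrix VX VY A := Matrix.of fun g h => E.e (Sum.inl g) (Sum.inr h)
    let AX : Matrix VX VX A := Matrix.of fun v w => if X.Adj v w then 1 else 0
    let AY : Matrix VY VY A := Matrix.of fun v w => if Y.Adj v w then 1 else 0
    U * Uᴴ = 1 ∧ Uᴴ * U = 1 ∧ AX * U = U * AY := by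
  intro U AX AY
  refine ⟨?_, ?_, ?_⟩
  · ext g g'
    simp only [U, mul_apply, conjTranspose_apply, of_apply, E.selfadj]
    rcases eq_or_ne g g' with rfl | hg
    · simp [E.idem, E.sum_e_inl_inr]
    · simp [one_apply_ne hg, E.e_mul_e_eq_zero_of_ne_left hg]
  · ext h h'
    simp only [U, mul_apply, conjTranspose_apply, of_apply, E.selfadj]
    rcases eq_or_ne h h' with rfl | hh
    · simp [E.idem, E.sum_e_inl_inr_left]
    · simp [one_apply_ne hh, E.e_mul_e_eq_zero_of_ne_right _ hh]
  · ext g h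
    simp only [U, AX, AY, mul_apply, of_apply]
    calc ∑ g', (if X.Adj g g' then 1 else 0) * E.e (Sum.inl g') (Sum.inr h)
        = ∑ g', ∑ h', if X.Adj g g' then
            E.e (Sum.inl g) (Sum.inr h') * E.e (Sum.inl g') (Sum.inr h) else 0 := by
          refine Finset.sum_congr rfl fun g' _ => ?_
          split_ifs
          · rw [← Finset.sum_mul, E.sum_e_inl_inr]
          · simp
      _ = ∑ h', ∑ g', if Y.Adj h' h then
            E.e (Sum.inl g) (Sum.inr h') * E.e (Sum.inl g') (Sum.inr h) else 0 := by
          rw [Finset.sum_comm]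
          refine Finset.sum_congr rfl fun h' _ => Finset.sum_congr rfl fun g' _ => ?_
          by_cases hadj : X.Adj g g' ↔ Y.Adj h' h
          · simp only [hadj]
          · simp [E.e_mul_e_eq_zero_of_not_adj_iff hadj]
      _ = ∑ h', E.e (Sum.inl g) (Sum.inr h') * (if Y.Adj h' h then 1 else 0) := by
          refine Finset.sum_congr rfl fun h' _ => ?_
          split_ifs
          · rw [← Finset.mul_sum, E.sum_e_inl_inr_left]
          · simp
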